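/- Let n ≥ 2, p ∈ {1,…,n−1} with gcd(n,p) = 1, q ∈ {1,…,n−1} with pq ≡ 1 (mod n), let y be a type (i) coupling, and let b > 0. Then for every ξ ∈ A_y^+ and every ℓ ∈ {1,…,n}: ws_b(ny) ≠ 0, each denominator ws_b(Σ_{k=ℓ}^{m−1} ξ_k) (m = ℓ+1,…,ℓ+n−1) is strictly positive, and the elliptic quantities z^b_ℓ(ξ,±y) = sgn(ws_b(ny)) · ∏_{m=ℓ+1}^{ℓ+n−1} [ ws_b(Σ_{k=ℓ}^{m−1} ξ_k ∓ y) / ws_b(Σ_{k=ℓ}^{m−1} ξ_k) ] satisfy z^b_ℓ(ξ,y) > 0 and z^b_ℓ(ξ,−y) > 0. -/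

import Mathlib

open Finset Matrix
open scoped BigOperators Real

noncomputable section

/-- Entries of the `(n-1) × (n-1)` integer matrix `A` (1-based indices):
`A_{j,k} = 1` if `1 ≤ j ≤ n-p` and `j ≤ k < j+p`, `A_{j,k} = -1` if
`n-p < j ≤ n-1` and `j+p-n ≤ k < j`, and `0` otherwise. -/
def Aent (n p : ℕ) (j k : ℕ) : ℤ :=
  if j ≤ n - p ∧ j ≤ k ∧ k < j + p then 1
  else if n - p < j ∧ j + p ≤ k + n ∧ k < j then -1
  else 0

open Classical in
/-- Entries of the binary matrix `B`: `B_{m,k} = 0` iff `k - m ≡ ℓ p (mod n)`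
for some `ℓ ∈ {1, …, n-q}`, else `1`. -/
def Bent (n p q : ℕ) (m k : ℕ) : ℤ :=
  if ∃ ℓ ∈ Finset.Icc 1 (n - q), ((k : ℤ) - (m : ℤ)) ≡ ((ℓ * p : ℕ) : ℤ) [ZMOD (n : ℤ)]
  then 0 else 1

open Classical in
/-- Entries of the binary matrix `C`: `C_{m,k} = 0` iff `k ≡ ℓ p (mod n)`
for some `ℓ ∈ {1, …, n-q}`, else `1`. -/
def Cent (n p q : ℕ) (m k : ℕ) : ℤ :=
  if ∃ ℓ ∈ Finset.Icc 1 (n - q), ((k : ℤ)) ≡ ((ℓ * p : ℕ) : ℤ) [ZMOD (n : ℤ)]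
  then 0 else 1

/-- Entries of `Ω = B - C`. -/
def Ωent (n p q : ℕ) (m k : ℕ) : ℤ := Bent n p q m k - Cent n p q m k

/-- The matrix `A` as an `(n-1) × (n-1)` integer matrix. -/
def Amat (n p : ℕ) : Matrix (Fin (n - 1)) (Fin (n - 1)) ℤ :=
  fun j k => Aent n p (j.1 + 1) (k.1 + 1)

/-- The matrix `Ω = B - C` as an `(n-1) × (n-1)` integer matrix. -/
def Ωmat (n p q : ℕ) : Matrix (Fin (n - 1)) (Fin (n - 1)) ℤ :=
  fun j k => Ωent n p q (j.1 + 1) (k.1 + 1)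

/-- Cyclic window sum `ξ_ℓ + ξ_{ℓ+1} + ⋯ + ξ_{ℓ+d-1}`. -/
def wsum (ξ : ℕ → ℝ) (ℓ d : ℕ) : ℝ := ∑ m ∈ Finset.range d, ξ (ℓ + m)

/-- First type (i) interval: `(p/n - 1/(nq))π < y < pπ/n` (so `M = pπ - ny > 0`). -/
def typeI1 (n p q : ℕ) (y : ℝ) : Prop :=
  ((p : ℝ) / n - 1 / ((n : ℝ) * q)) * Real.pi < y ∧ y < (p : ℝ) * Real.pi / n

/-- Second type (i) interval: `pπ/n < y < (p/n + 1/(n(n-q)))π` (so `M = pπ - ny < 0`). -/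
def typeI2 (n p q : ℕ) (y : ℝ) : Prop :=
  (p : ℝ) * Real.pi / n < y ∧ y < ((p : ℝ) / n + 1 / ((n : ℝ) * ((n : ℝ) - q))) * Real.pi

/-- `M = pπ - ny`. -/
def Mval (n p : ℕ) (y : ℝ) : ℝ := (p : ℝ) * Real.pi - (n : ℝ) * y

/-- Membership of `ξ` (a cyclic sequence of reals, indices `1, …, n`) in the open
domain `A_y^+`: cyclic convention `ξ_{m+n} = ξ_m`, positivity, total sum `π`, and
`sgn(M)(ξ_j + ⋯ + ξ_{j+p-1} - y) > 0` for `j = 1, …, n`. -/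
def inAy (n p : ℕ) (y : ℝ) (ξ : ℕ → ℝ) : Prop :=
  (∀ m, ξ (m + n) = ξ m) ∧
  (∀ k, 1 ≤ k → k ≤ n → 0 < ξ k) ∧
  (∑ k ∈ Finset.Icc 1 n, ξ k = Real.pi) ∧
  (∀ j, 1 ≤ j → j ≤ n → 0 < Real.sign (Mval n p y) * (wsum ξ j p - y))

/-- `|u_j(ξ)|² = sgn(M) (ξ_j + ⋯ + ξ_{j+p-1} - y)`. -/
def usq (n p : ℕ) (y : ℝ) (ξ : ℕ → ℝ) (j : ℕ) : ℝ :=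
  Real.sign (Mval n p y) * (wsum ξ j p - y)

/-- `z_ℓ(ξ, w) = sgn(sin(ny)) ∏_{d=1}^{n-1} sin(ξ_ℓ + ⋯ + ξ_{ℓ+d-1} - w)/sin(ξ_ℓ + ⋯ + ξ_{ℓ+d-1})`;
the paper's `z_ℓ(ξ, ±y)` is obtained at `w = ±y`. -/
def zfun (n : ℕ) (y : ℝ) (ξ : ℕ → ℝ) (w : ℝ) (ℓ : ℕ) : ℝ :=
  Real.sign (Real.sin ((n : ℝ) * y)) *
    ∏ d ∈ Finset.Icc 1 (n - 1), Real.sin (wsum ξ ℓ d - w) / Real.sin (wsum ξ ℓ d)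

/-- `x_j - x_ℓ` expressed through `ξ`: `ξ_ℓ + ⋯ + ξ_{j-1}` for `ℓ ≤ j`, antisymmetric. -/
def xdiff (ξ : ℕ → ℝ) (j ℓ : ℕ) : ℝ :=
  if ℓ ≤ j then wsum ξ ℓ (j - ℓ) else -(wsum ξ j (ℓ - j))

/-- `ρ(θ)_ℓ = exp(i(θ_{ℓ-1} - θ_ℓ))` (with the conventions `θ_0 = θ_n = 0` imposed
as hypotheses on `θ`). -/
def ρfun (θ : ℕ → ℝ) (ℓ : ℕ) : ℂ :=
  Complex.exp (Complex.I * ((θ (ℓ - 1) - θ ℓ : ℝ) : ℂ))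

/-- `Δ_j(θ) = exp(i Σ_{k=1}^{n-1} Ω_{j,k} θ_k)` for `1 ≤ j ≤ n-1`, and `Δ_n(θ) = 1`. -/
def Δfun (n p q : ℕ) (θ : ℕ → ℝ) (j : ℕ) : ℂ :=
  if j = n then 1
  else Complex.exp (Complex.I *
    ((∑ k ∈ Finset.Icc 1 (n - 1), (Ωent n p q j k : ℝ) * θ k : ℝ) : ℂ))

/-- The local trigonometric Lax matrix
`L(ξ,θ)_{j,ℓ} = [sin y / sin(x_j - x_ℓ + y)] v_j(ξ,y) v_ℓ(ξ,-y) ρ(θ)_ℓ`. -/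
def Lloc (n : ℕ) (y : ℝ) (ξ θ : ℕ → ℝ) (j ℓ : ℕ) : ℂ :=
  ((Real.sin y / Real.sin (xdiff ξ j ℓ + y) : ℝ) : ℂ) *
    ((Real.sqrt (zfun n y ξ y j) : ℝ) : ℂ) *
    ((Real.sqrt (zfun n y ξ (-y) ℓ) : ℝ) : ℂ) * ρfun θ ℓ

/-- The embedding map `ℰ(ξ,θ)_j = |u_j(ξ)| Δ_j(θ)^{sgn M}` for `j = 1, …, n-1`
and `ℰ(ξ,θ)_n = |u_n(ξ)|` (note `Δ_n = 1`). -/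
def Emap (n p q : ℕ) (y : ℝ) (ξ θ : ℕ → ℝ) (j : ℕ) : ℂ :=
  ((Real.sqrt (usq n p y ξ j) : ℝ) : ℂ) *
    Δfun n p q θ j ^ (if 0 < Mval n p y then (1 : ℤ) else -1)

/-- `σ(ℓ) = ℓ + n - p` if `1 ≤ ℓ ≤ p`, and `σ(ℓ) = ℓ - p` if `p < ℓ ≤ n`. -/
def σmap (n p : ℕ) (ℓ : ℕ) : ℕ := if ℓ ≤ p then ℓ + n - p else ℓ - p

/-- The Weierstrass-type function
`ws_b(z) = sin z ∏_{m=1}^∞ (1 + sin² z / sinh²(2 m b))` with `ω = π/2`, `ω' = i b`. -/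
def wsb (b : ℝ) (z : ℂ) : ℂ :=
  Complex.sin z *
    ∏' m : ℕ, (1 + Complex.sin z ^ 2 / Complex.sinh (2 * ((m : ℂ) + 1) * (b : ℂ)) ^ 2)

/-- Elliptic analogue of `zfun`, built from `ws_b` instead of `sin`. -/
def zbfun (b : ℝ) (n : ℕ) (y : ℝ) (ξ : ℕ → ℝ) (w : ℝ) (ℓ : ℕ) : ℝ :=
  Real.sign ((wsb b (((n : ℝ) * y : ℝ) : ℂ)).re) *
    ∏ d ∈ Finset.Icc 1 (n - 1),
      (wsb b ((wsum ξ ℓ d - w : ℝ) : ℂ)).re / (wsb b ((wsum ξ ℓ d : ℝ) : ℂ)).re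

/-- The local elliptic Lax matrix with spectral parameter `lam`. -/
def Lbloc (b : ℝ) (n : ℕ) (y : ℝ) (lam : ℂ) (ξ θ : ℕ → ℝ) (j ℓ : ℕ) : ℂ :=
  (wsb b ((y : ℝ) : ℂ) / wsb b lam) *
    (wsb b (((xdiff ξ j ℓ : ℝ) : ℂ) + lam) / wsb b ((xdiff ξ j ℓ + y : ℝ) : ℂ)) *
    ((Real.sqrt (zbfun b n y ξ y j) : ℝ) : ℂ) *
    ((Real.sqrt (zbfun b n y ξ (-y) ℓ) : ℝ) : ℂ) * ρfun θ ℓ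

/-- The subset `S = {ℓ p mod n : ℓ = 1, …, n-q}` of `ℤ/nℤ`. -/
def Sset (n p q : ℕ) : Finset (ZMod n) :=
  (Finset.Icc 1 (n - q)).image (fun ℓ => ((ℓ * p : ℕ) : ZMod n))

/-- The subset `S_i = {i + ℓ mod n : ℓ = 0, …, p-1}` of `ℤ/nℤ`. -/
def Siset (n p : ℕ) (i : ZMod n) : Finset (ZMod n) :=
  (Finset.range p).image (fun ℓ : ℕ => i + (ℓ : ZMod n))

/-- `I_i = |S_i ∩ S|`. -/
def Inum (n p q : ℕ) (i : ZMod n) : ℕ := (Siset n p i ∩ Sset n p q).card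

/-- The function `W_j(ξ)` of Statement 13. -/
def Wfun (n p : ℕ) (y : ℝ) (ξ : ℕ → ℝ) (j : ℕ) : ℝ :=
  (Real.sin (usq n p y ξ j) / usq n p y ξ j) *
    ((-1 : ℝ) ^ (p - 1) / Real.sin (wsum ξ j p)) *
    ∏ d ∈ (Finset.Icc 1 (n - 1)).erase p,
      Real.sin (wsum ξ j d - y) / Real.sin (wsum ξ j d)

theorem wsum_add (ξ : ℕ → ℝ) (j a c : ℕ) :
    wsum ξ j (a + c) = wsum ξ j a + wsum ξ (j + a) c := by
  simp [wsum, Finset.sum_range_add, add_assoc]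

theorem wsum_mono {ξ : ℕ → ℝ} (hpos : ∀ k, 0 < ξ k) (j : ℕ) {a c : ℕ} (h : a ≤ c) :
    wsum ξ j a ≤ wsum ξ j c := by
  obtain ⟨e, rfl⟩ := Nat.exists_eq_add_of_le h
  rw [wsum_add]
  have : 0 ≤ wsum ξ (j + a) e := Finset.sum_nonneg fun m _ => (hpos _).le
  linarith

theorem wsum_pos {ξ : ℕ → ℝ} (hpos : ∀ k, 0 < ξ k) (j : ℕ) {d : ℕ} (hd : 1 ≤ d) :
    0 < wsum ξ j d :=
  Finset.sum_pos (fun m _ => hpos _) ⟨0, by simp; omega⟩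

theorem wsum_period {n : ℕ} {ξ : ℕ → ℝ} (hper : ∀ m, ξ (m + n) = ξ m)
    (hsum : ∑ k ∈ Finset.Icc 1 n, ξ k = Real.pi) (j : ℕ) : wsum ξ j n = Real.pi := by
  have step : ∀ j, wsum ξ (j + 1) n = wsum ξ j n := by
    intro j
    have h1 := wsum_add ξ j 1 n
    have h2 := wsum_add ξ j n 1
    rw [add_comm 1 n] at h1
    have h3 : wsum ξ j 1 = ξ j := by simp [wsum]
    have h4 : wsum ξ (j + n) 1 = ξ j := by simp [wsum, hper]
    linarith
  have hconst : ∀ j, wsum ξ j n = wsum ξ 0 n := by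
    intro j
    induction j with
    | zero => rfl
    | succ j ih => rw [step, ih]
  have hI : Finset.Icc 1 n = Finset.Ico 1 (n + 1) := by ext; simp
  rw [hconst, ← hconst 1, ← hsum, hI, Finset.sum_Ico_eq_sum_range, wsum, Nat.add_sub_cancel]

theorem wsum_mul_period {n : ℕ} {ξ : ℕ → ℝ} (hn : ∀ j, wsum ξ j n = Real.pi) (j k : ℕ) :
    wsum ξ j (k * n) = k * Real.pi := by
  induction k with
  | zero => simp [wsum]
  | succ k ih => rw [add_mul, one_mul, wsum_add, ih, hn]; push_cast; ring

theorem mul_le_wsum_mul {ξ : ℕ → ℝ} {p : ℕ} {y : ℝ} (h : ∀ j, y ≤ wsum ξ j p) (j r : ℕ) :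
    r * y ≤ wsum ξ j (r * p) := by
  induction r with
  | zero => simp [wsum]
  | succ r ih =>
    rw [add_mul, one_mul, wsum_add]
    push_cast
    linarith [h (j + r * p)]

theorem wsum_mul_le_mul {ξ : ℕ → ℝ} {p : ℕ} {y : ℝ} (h : ∀ j, wsum ξ j p ≤ y) (j r : ℕ) :
    wsum ξ j (r * p) ≤ r * y := by
  induction r with
  | zero => simp [wsum]
  | succ r ih =>
    rw [add_mul, one_mul, wsum_add]
    push_cast
    linarith [h (j + r * p)]

/-- If every window of length `p` exceeds `y` and `p * q = k * n + 1` with `k * π < q * y`,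
then every shorter window is below `y`. -/
theorem wsum_lt_of_lt {n p q k : ℕ} {ξ : ℕ → ℝ} {y : ℝ} (hpos : ∀ i, 0 < ξ i)
    (hn : ∀ j, wsum ξ j n = Real.pi) (hq : 1 ≤ q) (hk : p * q = k * n + 1)
    (hy : k * Real.pi < q * y) (hwin : ∀ j, y < wsum ξ j p) (j : ℕ) {d : ℕ} (hd : d < p) :
    wsum ξ j d < y := by
  obtain ⟨r, rfl⟩ := Nat.exists_eq_add_of_le' hq
  obtain ⟨s, rfl⟩ := Nat.exists_eq_add_of_lt hd
  have hlen : k * n = (d + s) + r * (d + s + 1) := by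
    have : (d + s + 1) * (r + 1) = (d + s) + r * (d + s + 1) + 1 := by ring
    omega
  have h1 := wsum_add ξ j (d + s) (r * (d + s + 1))
  rw [← hlen, wsum_mul_period hn] at h1
  have h2 := mul_le_wsum_mul (fun j => (hwin j).le) (j + (d + s)) r
  have h3 := wsum_mono hpos j (Nat.le_add_right d s)
  push_cast at hy
  linarith

/-- If every window of length `p` is below `y` and `p * q + 1 = k * n` with `q * y < k * π`,
then every longer window exceeds `y`. -/
theorem lt_wsum_of_lt {n p q k : ℕ} {ξ : ℕ → ℝ} {y : ℝ} (hpos : ∀ i, 0 < ξ i)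
    (hn : ∀ j, wsum ξ j n = Real.pi) (hq : 1 ≤ q) (hk : p * q + 1 = k * n)
    (hy : q * y < k * Real.pi) (hwin : ∀ j, wsum ξ j p < y) (j : ℕ) {d : ℕ} (hd : p < d) :
    y < wsum ξ j d := by
  obtain ⟨r, rfl⟩ := Nat.exists_eq_add_of_le' hq
  have hlen : k * n = (p + 1) + r * p := by rw [← hk]; ring
  have h1 := wsum_add ξ j (p + 1) (r * p)
  rw [← hlen, wsum_mul_period hn] at h1
  have h2 := wsum_mul_le_mul (fun j => (hwin j).le) (j + (p + 1)) r
  have h3 := wsum_mono hpos j (Nat.succ_le_of_lt hd)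
  push_cast at hy
  simp only [Nat.succ_eq_add_one] at h3
  linarith

theorem summable_sq_div_sinh_sq {b : ℝ} (hb : 0 < b) (s : ℝ) :
    Summable fun m : ℕ => s ^ 2 / Real.sinh (2 * ((m : ℝ) + 1) * b) ^ 2 := by
  have hbase : Summable fun m : ℕ => 1 / ((m : ℝ) + 1) ^ 2 := by
    have := (summable_nat_add_iff (f := fun m : ℕ => 1 / (m : ℝ) ^ 2) 1).2
      (Real.summable_one_div_nat_pow.2 one_lt_two)
    simpa using this
  refine Summable.of_nonneg_of_le (fun m => by positivity) (fun m => ?_)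
    (hbase.mul_left (s ^ 2 / (2 * b) ^ 2))
  have hx : 0 < 2 * ((m : ℝ) + 1) * b := by positivity
  have hsinh : 2 * ((m : ℝ) + 1) * b ≤ Real.sinh (2 * ((m : ℝ) + 1) * b) :=
    Real.self_le_sinh_iff.2 hx.le
  calc s ^ 2 / Real.sinh (2 * ((m : ℝ) + 1) * b) ^ 2
      ≤ s ^ 2 / (2 * ((m : ℝ) + 1) * b) ^ 2 := by gcongr
    _ = s ^ 2 / (2 * b) ^ 2 * (1 / ((m : ℝ) + 1) ^ 2) := by field_simp

/-- On the real line `ws_b` is a positive multiple of the sine function. -/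
theorem exists_wsb_ofReal_eq {b : ℝ} (hb : 0 < b) (x : ℝ) :
    ∃ P : ℝ, 0 < P ∧ wsb b (x : ℂ) = ((Real.sin x * P : ℝ) : ℂ) := by
  have hs := summable_sq_div_sinh_sq hb (Real.sin x)
  have hlog := Real.summable_log_one_add_of_summable hs
  have hfac : ∀ m : ℕ, 0 < 1 + Real.sin x ^ 2 / Real.sinh (2 * ((m : ℝ) + 1) * b) ^ 2 :=
    fun m => by positivity
  have hmul := Real.multipliable_of_summable_log hfac hlog
  refine ⟨∏' m : ℕ, (1 + Real.sin x ^ 2 / Real.sinh (2 * ((m : ℝ) + 1) * b) ^ 2), ?_, ?_⟩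
  · rw [← Real.rexp_tsum_eq_tprod hfac hlog]
    exact Real.exp_pos _
  · have hcast := hmul.map_tprod Complex.ofRealHom Complex.continuous_ofReal
    simp only [Complex.ofRealHom_eq_coe] at hcast
    rw [wsb, Complex.ofReal_mul, hcast]
    push_cast
    rfl

theorem neg_one_pow_mul_prod_pos {N t : ℕ} {g : ℕ → ℝ} (ht : 1 ≤ t) (htN : t ≤ N + 1)
    (hneg : ∀ d, 1 ≤ d → d < t → g d < 0) (hpos : ∀ d, t ≤ d → d ≤ N → 0 < g d) :
    0 < (-1 : ℝ) ^ (t - 1) * ∏ d ∈ Finset.Icc 1 N, g d := by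
  have hI : Finset.Icc 1 N = Finset.Ico 1 (N + 1) := by ext; simp
  have hpow : (-1 : ℝ) ^ (t - 1) = ∏ _d ∈ Finset.Ico 1 t, (-1 : ℝ) := by simp
  rw [hI, ← Finset.prod_Ico_consecutive g ht htN, hpow, ← mul_assoc, ← Finset.prod_mul_distrib]
  refine mul_pos (Finset.prod_pos fun d hd => ?_) (Finset.prod_pos fun d hd => ?_)
  · rw [Finset.mem_Ico] at hd
    linarith [hneg d hd.1 hd.2]
  · rw [Finset.mem_Ico] at hd
    exact hpos d hd.1 (by omega)

theorem sign_eq_neg_one_pow {s : ℝ} {k : ℕ} (h : 0 < (-1 : ℝ) ^ k * s) :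
    Real.sign s = (-1) ^ k := by
  rcases neg_one_pow_eq_or ℝ k with hk | hk <;> rw [hk] at h ⊢
  · exact Real.sign_of_pos (by linarith)
  · exact Real.sign_of_neg (by linarith)

/-- For a type (i) coupling there is a threshold length `t` such that windows shorter than `t` are
below `y`, the others exceed `y`, and `sin (n y)` has sign `(-1) ^ (t - 1)`. -/
theorem exists_threshold {n p q : ℕ} (hp1 : 1 ≤ p) (hpn : p ≤ n - 1)
    (hq1 : 1 ≤ q) (hqn : q ≤ n - 1) (hpq : p * q ≡ 1 [MOD n])
    {y : ℝ} (hy : typeI1 n p q y ∨ typeI2 n p q y) {ξ : ℕ → ℝ} (hpos : ∀ k, 0 < ξ k)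
    (hn : ∀ j, wsum ξ j n = Real.pi)
    (hwin : ∀ j, 0 < Real.sign (Mval n p y) * (wsum ξ j p - y)) :
    ∃ t, 1 ≤ t ∧ t ≤ n ∧ 0 < (-1 : ℝ) ^ (t - 1) * Real.sin (n * y) ∧
      (∀ j d, d < t → wsum ξ j d < y) ∧ ∀ j d, t ≤ d → y < wsum ξ j d := by
  have hpi := Real.pi_pos
  have hn0 : (0 : ℝ) < n := by exact_mod_cast (by omega : 0 < n)
  obtain ⟨k, hk⟩ : ∃ k, p * q = k * n + 1 := by
    obtain ⟨k, hk⟩ := (Nat.modEq_iff_dvd' (Nat.mul_pos hp1 hq1 : 1 ≤ p * q)).1 hpq.symm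
    have := Nat.mul_pos hp1 hq1
    exact ⟨k, by rw [mul_comm k]; omega⟩
  have hkR : (p : ℝ) * q = k * n + 1 := by exact_mod_cast hk
  rcases hy with ⟨hlo, hhi⟩ | ⟨hlo, hhi⟩
  · have hq0 : (0 : ℝ) < q := by exact_mod_cast hq1
    have hq1R : (1 : ℝ) ≤ q := by exact_mod_cast hq1
    rw [lt_div_iff₀ hn0] at hhi
    have hM : 0 < Mval n p y := by rw [Mval]; linarith
    have hky : (k : ℝ) * Real.pi < q * y := by
      have : ((p : ℝ) / n - 1 / (n * q)) * Real.pi = k * Real.pi / q := by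
        field_simp
        linear_combination hkR
      rw [this, div_lt_iff₀ hq0] at hlo
      linarith
    have hwin' : ∀ j, y < wsum ξ j p := fun j => by
      have := hwin j
      rw [Real.sign_of_pos hM] at this
      linarith
    have hMlt : Mval n p y < Real.pi := by
      have : q * Mval n p y < Real.pi := by
        rw [Mval]
        nlinarith
      nlinarith
    refine ⟨p, hp1, by omega, ?_, fun j d hd => wsum_lt_of_lt hpos hn hq1 hk hky hwin' j hd,
      fun j d hd => (hwin' j).trans_le (wsum_mono hpos j hd)⟩
    have hsin : Real.sin (n * y) = -((-1) ^ p * Real.sin (Mval n p y)) := by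
      rw [← Real.sin_nat_mul_pi_sub, Mval]
      ring_nf
    have hsM := Real.sin_pos_of_pos_of_lt_pi hM hMlt
    obtain ⟨r, rfl⟩ := Nat.exists_eq_add_of_le' hp1
    rw [hsin, Nat.add_sub_cancel, pow_succ]
    rcases neg_one_pow_eq_or ℝ r with h | h <;> rw [h] <;> linarith
  · have hqn' : q ≤ n := by omega
    obtain ⟨q', hq'⟩ := Nat.exists_eq_add_of_le hqn'
    have hq'1 : 1 ≤ q' := by omega
    have hq1R : (1 : ℝ) ≤ q' := by exact_mod_cast hq'1
    have hq0 : (0 : ℝ) < q' := by linarith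
    have hq'R : (n : ℝ) - q = q' := by rw [hq']; push_cast; ring
    have hkp : k ≤ p := by
      by_contra! h
      have h1 : p * q ≤ p * n := Nat.mul_le_mul_left p hqn'
      have h2 : p * n ≤ k * n := Nat.mul_le_mul_right n h.le
      omega
    obtain ⟨k', hk'⟩ := Nat.exists_eq_add_of_le hkp
    have hk2 : p * q' + 1 = k' * n := by
      have h1 : p * n = p * q + p * q' := by rw [hq']; ring
      have h2 : p * n = k * n + k' * n := by rw [hk']; ring
      omega
    have hk2R : (p : ℝ) * q' + 1 = k' * n := by exact_mod_cast hk2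
    rw [div_lt_iff₀ hn0] at hlo
    have hM : Mval n p y < 0 := by rw [Mval]; linarith
    have hky : q' * y < (k' : ℝ) * Real.pi := by
      have : ((p : ℝ) / n + 1 / (n * (n - q))) * Real.pi = k' * Real.pi / q' := by
        rw [hq'R]
        field_simp
        linear_combination hk2R
      rw [this, lt_div_iff₀ hq0] at hhi
      linarith
    have hwin' : ∀ j, wsum ξ j p < y := fun j => by
      have := hwin j
      rw [Real.sign_of_neg hM] at this
      linarith
    have hMlt : -Mval n p y < Real.pi := by
      have : q' * -Mval n p y < Real.pi := by
        rw [Mval]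
        nlinarith
      nlinarith
    refine ⟨p + 1, by omega, by omega, ?_,
      fun j d hd => (wsum_mono hpos j (Nat.lt_succ_iff.1 hd)).trans_lt (hwin' j),
      fun j d hd => lt_wsum_of_lt hpos hn hq'1 hk2 hky hwin' j hd⟩
    have hsin : Real.sin (n * y) = (-1) ^ p * Real.sin (-Mval n p y) := by
      rw [← Real.sin_add_nat_mul_pi, Mval]
      ring_nf
    have hsM := Real.sin_pos_of_pos_of_lt_pi (neg_pos.2 hM) hMlt
    rw [hsin, Nat.add_sub_cancel]
    rcases neg_one_pow_eq_or ℝ p with h | h <;> rw [h] <;> linarith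

/-- `zbfun` is positive as soon as its trigonometric numerators and denominators have the
expected signs. -/
theorem zbfun_pos {b : ℝ} (hb : 0 < b) {n t ℓ : ℕ} {y w : ℝ} {ξ : ℕ → ℝ}
    (hny : 0 < (-1 : ℝ) ^ (t - 1) * Real.sin (n * y))
    (hden : ∀ d, 1 ≤ d → d ≤ n - 1 → 0 < Real.sin (wsum ξ ℓ d))
    (hnum : 0 < (-1 : ℝ) ^ (t - 1) * ∏ d ∈ Finset.Icc 1 (n - 1), Real.sin (wsum ξ ℓ d - w)) :
    0 < zbfun b n y ξ w ℓ := by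
  choose P hP hPw using fun x => exists_wsb_ofReal_eq hb x
  have hsign : Real.sign (Real.sin (n * y) * P (n * y)) = (-1) ^ (t - 1) :=
    sign_eq_neg_one_pow (by rw [← mul_assoc]; exact mul_pos hny (hP _))
  simp only [zbfun, hPw, Complex.ofReal_re, hsign]
  rw [Finset.prod_div_distrib, Finset.prod_mul_distrib, mul_div_assoc', ← mul_assoc]
  refine div_pos (mul_pos hnum (Finset.prod_pos fun _ _ => hP _)) (Finset.prod_pos fun d hd => ?_)
  rw [Finset.mem_Icc] at hd
  exact mul_pos (hden d hd.1 hd.2) (hP _)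

/-- For a type (i) coupling, `b > 0`, `ξ ∈ A_y^+` and `ℓ ∈ {1, …, n}`:
`ws_b(ny) ≠ 0`, each denominator `ws_b(ξ_ℓ + ⋯ + ξ_{ℓ+d-1})` is strictly positive (a
positive real number), and `z^b_ℓ(ξ,y) > 0`, `z^b_ℓ(ξ,-y) > 0`. -/
theorem stmt17 (n p q : ℕ) (hn : 2 ≤ n) (hp1 : 1 ≤ p) (hpn : p ≤ n - 1)
    (hgcd : Nat.gcd n p = 1) (hq1 : 1 ≤ q) (hqn : q ≤ n - 1)
    (hpq : p * q ≡ 1 [MOD n])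
    (b : ℝ) (hb : 0 < b)
    (y : ℝ) (hy : typeI1 n p q y ∨ typeI2 n p q y)
    (ξ : ℕ → ℝ) (hξ : inAy n p y ξ)
    (ℓ : ℕ) (hℓ1 : 1 ≤ ℓ) (hℓn : ℓ ≤ n) :
    wsb b (((n : ℝ) * y : ℝ) : ℂ) ≠ 0 ∧
    (∀ d, 1 ≤ d → d ≤ n - 1 →
      0 < (wsb b ((wsum ξ ℓ d : ℝ) : ℂ)).re ∧ (wsb b ((wsum ξ ℓ d : ℝ) : ℂ)).im = 0) ∧
    0 < zbfun b n y ξ y ℓ ∧ 0 < zbfun b n y ξ (-y) ℓ := by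
  obtain ⟨hper, hpos1, hsum, hwin1⟩ := hξ
  have hn0 : 0 < n := by omega
  have hreduce : ∀ j : ℕ, ∃ i, 1 ≤ i ∧ i ≤ n ∧ ∀ m, ξ (j + m) = ξ (i + m) := by
    intro j
    have hperiod : Function.Periodic ξ n := hper
    rcases Nat.eq_zero_or_pos (j % n) with h | h
    · refine ⟨n, hn0, le_rfl, fun m => ?_⟩
      rw [← hperiod.map_mod_nat, ← hperiod.map_mod_nat (n + m), Nat.add_mod, h]
      simp
    · refine ⟨j % n, h, (Nat.mod_lt _ hn0).le, fun m => ?_⟩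
      rw [← hperiod.map_mod_nat, ← hperiod.map_mod_nat (j % n + m)]
      simp
  have hpos : ∀ k, 0 < ξ k := fun k => by
    obtain ⟨i, hi1, hin, hi⟩ := hreduce k
    have h0 : ξ k = ξ i := hi 0
    exact h0 ▸ hpos1 i hi1 hin
  have hwin : ∀ j, 0 < Real.sign (Mval n p y) * (wsum ξ j p - y) := fun j => by
    obtain ⟨i, hi1, hin, hi⟩ := hreduce j
    have : wsum ξ j p = wsum ξ i p := Finset.sum_congr rfl fun m _ => hi m
    rw [this]
    exact hwin1 i hi1 hin
  have hfull := wsum_period hper hsum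
  obtain ⟨t, ht1, htn, hny, hlt, hgt⟩ := exists_threshold hp1 hpn hq1 hqn hpq hy hpos hfull hwin
  have hy0 : 0 < y := by simpa [wsum] using hlt 0 0 ht1
  have hyπ : y < Real.pi := hfull 0 ▸ hgt 0 n htn
  have hsplit : ∀ j d, d ≤ n → wsum ξ j d + wsum ξ (j + d) (n - d) = Real.pi := fun j d hd => by
    rw [← wsum_add, Nat.add_sub_cancel' hd, hfull]
  have hwlt : ∀ j d, 1 ≤ d → d ≤ n - 1 → wsum ξ j d < Real.pi := fun j d hd hdn => by
    have := wsum_pos hpos (j + d) (by omega : 1 ≤ n - d)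
    linarith [hsplit j d (by omega)]
  have hden : ∀ d, 1 ≤ d → d ≤ n - 1 → 0 < Real.sin (wsum ξ ℓ d) := fun d hd hdn =>
    Real.sin_pos_of_pos_of_lt_pi (wsum_pos hpos ℓ hd) (hwlt ℓ d hd hdn)
  have hsneg : ∀ j d, 1 ≤ d → d < t → Real.sin (wsum ξ j d - y) < 0 := fun j d hd hdt =>
    Real.sin_neg_of_neg_of_neg_pi_lt (by linarith [hlt j d hdt])
      (by linarith [wsum_pos hpos j hd])
  have hspos : ∀ j d, 1 ≤ d → t ≤ d → d ≤ n - 1 → 0 < Real.sin (wsum ξ j d - y) :=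
    fun j d hd hdt hdn => Real.sin_pos_of_pos_of_lt_pi (by linarith [hgt j d hdt])
      (by linarith [hwlt j d hd hdn])
  refine ⟨?_, fun d hd hdn => ?_, zbfun_pos hb hny hden ?_, zbfun_pos hb hny hden ?_⟩
  · obtain ⟨P, hP, h⟩ := exists_wsb_ofReal_eq hb (n * y)
    rw [h]
    refine Complex.ofReal_ne_zero.2 (mul_ne_zero (fun h0 => ?_) hP.ne')
    simp [h0] at hny
  · obtain ⟨P, hP, h⟩ := exists_wsb_ofReal_eq hb (wsum ξ ℓ d)
    rw [h, Complex.ofReal_re, Complex.ofReal_im]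
    exact ⟨mul_pos (hden d hd hdn) hP, rfl⟩
  · exact neg_one_pow_mul_prod_pos ht1 (by omega) (fun d => hsneg ℓ d)
      (fun d hdt => hspos ℓ d (by omega) hdt)
  · have hreflect : ∏ d ∈ Finset.Icc 1 (n - 1), Real.sin (wsum ξ ℓ d - -y) =
        ∏ d ∈ Finset.Icc 1 (n - 1), Real.sin (wsum ξ (ℓ + (n - d)) d - y) := by
      refine Finset.prod_bij' (fun d _ => n - d) (fun d _ => n - d) ?_ ?_ ?_ ?_ ?_
      · intro d hd
        rw [Finset.mem_Icc] at hd ⊢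
        omega
      · intro d hd
        rw [Finset.mem_Icc] at hd ⊢
        omega
      · intro d hd
        rw [Finset.mem_Icc] at hd
        omega
      · intro d hd
        rw [Finset.mem_Icc] at hd
        omega
      · intro d hd
        rw [Finset.mem_Icc] at hd
        rw [Nat.sub_sub_self (by omega : d ≤ n), ← Real.sin_pi_sub]
        congr 1
        linarith [hsplit ℓ d (by omega)]
    rw [hreflect]
    exact neg_one_pow_mul_prod_pos ht1 (by omega) (fun d => hsneg _ d)
      (fun d hdt => hspos _ d (by omega) hdt)

end
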